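/- arXiv:math/9910027 — 3 statements merged into one kernel-verified Lean document; each statement's English description precedes it below -/
import Mathlib

section
/- Let E be an inner product space over ℂ with two differentials d, d^c, formal adjoints δ, δ^c, the commutation relations d ∘ d^c + d^c ∘ d = 0 and d ∘ δ^c + δ^c ∘ d = 0, equal Laplacians, and Hodge decompositions for both (d, δ) and (d^c, δ^c). Let H := (ker d) ⊓ (ker δ). Then E admits the fivefold decomposition: the five submodules H, range (d ∘ d^c), range (d ∘ δ^c), range (δ ∘ d^c), range (δ ∘ δ^c) are independent and their supremum is all of E (internal direct sum E = H ⊕ Im d d^c ⊕ Im d δ^c ⊕ Im δ d^c ⊕ Im δ δ^c). -/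
open scoped ComplexInnerProductSpace

/-- `E` admits a Hodge decomposition for `(d, δ)`: the harmonic subspace
`H := ker d ⊓ ker δ`, the range of `d` and the range of `δ` are independent
submodules whose supremum is all of `E`. -/
def HodgeDecomposition {E : Type*} [NormedAddCommGroup E] [InnerProductSpace ℂ E]
    (d δ : E →ₗ[ℂ] E) : Prop :=
  iSupIndep ![LinearMap.ker d ⊓ LinearMap.ker δ, LinearMap.range d, LinearMap.range δ] ∧
    (LinearMap.ker d ⊓ LinearMap.ker δ) ⊔ LinearMap.range d ⊔ LinearMap.range δ = ⊤

section

open LinearMap Submodule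

variable {E : Type*} [NormedAddCommGroup E] [InnerProductSpace ℂ E] {d δ : E →ₗ[ℂ] E}

/-- Being a formal adjoint is a symmetric relation. -/
theorem formalAdjoint_symm (hadj : ∀ x y : E, ⟪d x, y⟫ = ⟪x, δ y⟫) (x y : E) :
    ⟪δ x, y⟫ = ⟪x, d y⟫ := by
  rw [← inner_conj_symm, ← hadj, inner_conj_symm]

/-- The harmonic subspace is the kernel of the Laplacian. -/
theorem ker_inf_ker_eq_ker_laplacian (hadj : ∀ x y : E, ⟪d x, y⟫ = ⟪x, δ y⟫) :
    ker d ⊓ ker δ = ker (d ∘ₗ δ + δ ∘ₗ d) := by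
  ext x
  simp only [mem_inf, mem_ker, LinearMap.add_apply, comp_apply]
  refine ⟨fun ⟨h₁, h₂⟩ => by simp [h₁, h₂], fun h => ?_⟩
  have key : ⟪δ x, δ x⟫ + ⟪d x, d x⟫ = 0 := by
    rw [← hadj (δ x) x, ← formalAdjoint_symm hadj (d x) x, ← inner_add_left, h, inner_zero_left]
  have hsq : ‖δ x‖ ^ 2 + ‖d x‖ ^ 2 = 0 := by
    rw [inner_self_eq_norm_sq_to_K, inner_self_eq_norm_sq_to_K] at key
    exact Complex.ofReal_injective (by simpa using key)
  constructor <;> rw [← norm_eq_zero] <;> nlinarith [sq_nonneg ‖δ x‖, sq_nonneg ‖d x‖]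

/-- Anticommutation of two operators passes to their formal adjoints. -/
theorem adjoint_anticomm {a a' b b' : E →ₗ[ℂ] E} (ha : ∀ x y : E, ⟪a x, y⟫ = ⟪x, a' y⟫)
    (hb : ∀ x y : E, ⟪b x, y⟫ = ⟪x, b' y⟫) (h : a ∘ₗ b + b ∘ₗ a = 0) (x : E) :
    a' (b' x) = -b' (a' x) := by
  rw [← add_eq_zero_iff_eq_neg]
  refine ext_inner_left ℂ fun y => ?_
  have hy : a (b y) + b (a y) = 0 := LinearMap.congr_fun h y
  rw [inner_add_right, ← ha, ← hb, ← hb, ← ha, ← inner_add_left, add_comm, hy]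
  simp

/-- A decomposition into harmonic elements and the images of `d` and `δ` is carried by any linear
map killing the harmonic elements to a decomposition of its range. -/
theorem range_le_range_comp_sup_range_comp
    (htop : (ker d ⊓ ker δ) ⊔ range d ⊔ range δ = ⊤) (f : E →ₗ[ℂ] E)
    (hf : ker d ⊓ ker δ ≤ ker f) : range f ≤ range (f ∘ₗ d) ⊔ range (f ∘ₗ δ) := by
  rw [range_eq_map, ← htop, Submodule.map_sup, Submodule.map_sup, le_ker_iff_map.1 hf,
    bot_sup_eq, range_comp, range_comp]

end

/-- Under the assumptions of the formality theorem (two commuting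
differentials with formal adjoints, equal Laplacians, and Hodge decompositions for both),
`E` admits the fivefold decomposition
`E = H ⊕ Im (d ∘ dc) ⊕ Im (d ∘ δc) ⊕ Im (δ ∘ dc) ⊕ Im (δ ∘ δc)`,
where `H := ker d ⊓ ker δ`. -/
theorem fivefold_decomposition
    {E : Type*} [NormedAddCommGroup E] [InnerProductSpace ℂ E]
    (d δ dc δc : E →ₗ[ℂ] E)
    (hd : d ∘ₗ d = 0) (hdc : dc ∘ₗ dc = 0)
    (hadj : ∀ x y : E, ⟪d x, y⟫ = ⟪x, δ y⟫)
    (hadjc : ∀ x y : E, ⟪dc x, y⟫ = ⟪x, δc y⟫)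
    (hcomm₁ : d ∘ₗ dc + dc ∘ₗ d = 0)
    (hcomm₂ : d ∘ₗ δc + δc ∘ₗ d = 0)
    (hlap : d ∘ₗ δ + δ ∘ₗ d = dc ∘ₗ δc + δc ∘ₗ dc)
    (hHodge : HodgeDecomposition d δ) (hHodgec : HodgeDecomposition dc δc) :
    iSupIndep ![LinearMap.ker d ⊓ LinearMap.ker δ, LinearMap.range (d ∘ₗ dc),
        LinearMap.range (d ∘ₗ δc), LinearMap.range (δ ∘ₗ dc), LinearMap.range (δ ∘ₗ δc)] ∧
      (LinearMap.ker d ⊓ LinearMap.ker δ) ⊔ LinearMap.range (d ∘ₗ dc) ⊔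
        LinearMap.range (d ∘ₗ δc) ⊔ LinearMap.range (δ ∘ₗ dc) ⊔
        LinearMap.range (δ ∘ₗ δc) = ⊤ := by
  have hadj' := formalAdjoint_symm hadj
  have hadjc' := formalAdjoint_symm hadjc
  have hker : LinearMap.ker dc ⊓ LinearMap.ker δc = LinearMap.ker d ⊓ LinearMap.ker δ := by
    rw [ker_inf_ker_eq_ker_laplacian hadj, ker_inf_ker_eq_ker_laplacian hadjc, hlap]
  have hdd (x : E) : d (d x) = 0 := LinearMap.congr_fun hd x
  have hdcdc (x : E) : dc (dc x) = 0 := LinearMap.congr_fun hdc x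
  have hddc (x : E) : d (dc x) = -dc (d x) :=
    add_eq_zero_iff_eq_neg.1 (LinearMap.congr_fun hcomm₁ x)
  have hdδc (x : E) : d (δc x) = -δc (d x) :=
    add_eq_zero_iff_eq_neg.1 (LinearMap.congr_fun hcomm₂ x)
  have hδδc := adjoint_anticomm hadj hadjc hcomm₁
  have hδdc := adjoint_anticomm hadj hadjc' hcomm₂
  have hdδ (x y : E) : ⟪d x, δ y⟫ = 0 := by rw [← hadj, hdd, inner_zero_left]
  have hdcδc (x y : E) : ⟪dc x, δc y⟫ = 0 := by rw [← hadjc, hdcdc, inner_zero_left]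
  constructor
  · refine (OrthogonalFamily.of_pairwise (𝕜 := ℂ) ?_).independent
    refine (Std.Symm.pairwise_on (r := fun U V : Submodule ℂ E => U ⟂ V) _).2 fun i j hij => ?_
    fin_cases i <;> fin_cases j <;> first | exact absurd hij (by decide) | skip
    all_goals
      rw [Submodule.isOrtho_iff_inner_eq]
      first
      | simp [hdδ]; done
      | simp [hddc, hdδc, hδδc, hδdc, hdcδc]; done
      | simp +contextual [← hadj, ← hadj']
  · have h₁ := range_le_range_comp_sup_range_comp hHodgec.2 d (hker.trans_le inf_le_left)
    have h₂ := range_le_range_comp_sup_range_comp hHodgec.2 δ (hker.trans_le inf_le_right)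
    rw [eq_top_iff, ← hHodge.2]
    simp only [sup_assoc]
    exact sup_le_sup_left ((sup_le_sup h₁ h₂).trans_eq (by simp only [sup_assoc])) _
end

section
/- Let E be an inner product space over ℂ with two differentials d, d^c, formal adjoints δ, δ^c, the commutation relations d ∘ d^c + d^c ∘ d = 0 and d ∘ δ^c + δ^c ∘ d = 0, equal Laplacians, and Hodge decompositions for both (d, δ) and (d^c, δ^c). Then d induces the zero homomorphism on the d^c-cohomology: for every x ∈ E with d^c x = 0, the element d x lies in range d^c. -/
open scoped ComplexInnerProductSpace

section FormalAdjoint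

variable {E : Type*} [NormedAddCommGroup E] [InnerProductSpace ℂ E] {d δ : E →ₗ[ℂ] E}

/-- An operator with a formal adjoint is injective on the range of that adjoint. -/
theorem formalAdjoint_apply_eq_zero (hadj : ∀ x y : E, ⟪d x, y⟫ = ⟪x, δ y⟫) {y : E}
    (h : d (δ y) = 0) : δ y = 0 := by
  rw [← inner_self_eq_zero (𝕜 := ℂ), ← hadj, h, inner_zero_left]

/-- The kernel of the Laplacian of a differential is contained in the kernel of the
differential. -/
theorem apply_eq_zero_of_laplacian_eq_zero (hd : d ∘ₗ d = 0)
    (hadj : ∀ x y : E, ⟪d x, y⟫ = ⟪x, δ y⟫) {h : E} (hΔ : d (δ h) + δ (d h) = 0) :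
    d h = 0 := by
  have hδd : δ (d h) = 0 := formalAdjoint_apply_eq_zero hadj <| by
    rw [eq_neg_of_add_eq_zero_right hΔ, map_neg, ← LinearMap.comp_apply, hd,
      LinearMap.zero_apply, neg_zero]
  rw [← inner_self_eq_zero (𝕜 := ℂ), hadj, hδd, inner_zero_right]

/-- Given a Hodge decomposition, a closed element is harmonic up to an exact one. -/
theorem HodgeDecomposition.exists_harmonic_add_of_apply_eq_zero
    (hHodge : HodgeDecomposition d δ) (hd : d ∘ₗ d = 0)
    (hadj : ∀ x y : E, ⟪d x, y⟫ = ⟪x, δ y⟫) {x : E} (hx : d x = 0) :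
    ∃ h a : E, d h = 0 ∧ δ h = 0 ∧ h + d a = x := by
  have hmem : x ∈ (LinearMap.ker d ⊓ LinearMap.ker δ) ⊔ LinearMap.range d ⊔
      LinearMap.range δ := hHodge.2 ▸ Submodule.mem_top
  obtain ⟨y, hy, z, ⟨b, rfl⟩, rfl⟩ := Submodule.mem_sup.1 hmem
  obtain ⟨h, ⟨hdh, hδh⟩, z, ⟨a, rfl⟩, rfl⟩ := Submodule.mem_sup.1 hy
  have hdd : d (d a) = 0 := LinearMap.congr_fun hd a
  have hb : δ b = 0 := formalAdjoint_apply_eq_zero hadj <| by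
    simpa [LinearMap.mem_ker.1 hdh, hdd] using hx
  exact ⟨h, a, hdh, hδh, by rw [hb, add_zero]⟩

end FormalAdjoint

/-- Under the assumptions of the formality theorem, `d` induces the zero
homomorphism on the `dc`-cohomology: for every `x` with `dc x = 0`, the element `d x`
lies in `range dc`. -/
theorem d_induces_zero_on_dc_cohomology
    {E : Type*} [NormedAddCommGroup E] [InnerProductSpace ℂ E]
    (d δ dc δc : E →ₗ[ℂ] E)
    (hd : d ∘ₗ d = 0) (hdc : dc ∘ₗ dc = 0)
    (hadj : ∀ x y : E, ⟪d x, y⟫ = ⟪x, δ y⟫)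
    (hadjc : ∀ x y : E, ⟪dc x, y⟫ = ⟪x, δc y⟫)
    (hcomm₁ : d ∘ₗ dc + dc ∘ₗ d = 0)
    (hcomm₂ : d ∘ₗ δc + δc ∘ₗ d = 0)
    (hlap : d ∘ₗ δ + δ ∘ₗ d = dc ∘ₗ δc + δc ∘ₗ dc)
    (hHodge : HodgeDecomposition d δ) (hHodgec : HodgeDecomposition dc δc) :
    ∀ x : E, dc x = 0 → d x ∈ LinearMap.range dc := by
  intro x hx
  obtain ⟨h, a, hdch, hδch, rfl⟩ := hHodgec.exists_harmonic_add_of_apply_eq_zero hdc hadjc hx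
  have hdh : d h = 0 := apply_eq_zero_of_laplacian_eq_zero hd hadj <| by
    simpa [hdch, hδch] using LinearMap.congr_fun hlap h
  have hanti : d (dc a) + dc (d a) = 0 := LinearMap.congr_fun hcomm₁ a
  exact ⟨-d a, by rw [map_neg, map_add, hdh, zero_add, eq_neg_of_add_eq_zero_left hanti]⟩
end

section
/- Let E be an inner product space over ℂ with two differentials d, d^c, formal adjoints δ, δ^c, the commutation relations d ∘ d^c + d^c ∘ d = 0 and d ∘ δ^c + δ^c ∘ d = 0, equal Laplacians, and Hodge decompositions for both (d, δ) and (d^c, δ^c). Then the inclusion of ker d^c into E is injective on d-cohomology: for every x ∈ E with d^c x = 0, if x = d u for some u ∈ E, then there exists z ∈ E with d^c z = 0 and x = d z. -/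
open scoped ComplexInnerProductSpace

/-- Under the assumptions of the formality theorem, the inclusion of
`ker dc` into `E` is injective on `d`-cohomology: if `dc x = 0` and `x = d u` for some
`u`, then `x = d z` for some `z` with `dc z = 0`. -/
theorem inclusion_injective_on_d_cohomology
    {E : Type*} [NormedAddCommGroup E] [InnerProductSpace ℂ E]
    (d δ dc δc : E →ₗ[ℂ] E)
    (hd : d ∘ₗ d = 0) (hdc : dc ∘ₗ dc = 0)
    (hadj : ∀ x y : E, ⟪d x, y⟫ = ⟪x, δ y⟫)
    (hadjc : ∀ x y : E, ⟪dc x, y⟫ = ⟪x, δc y⟫)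
    (hcomm₁ : d ∘ₗ dc + dc ∘ₗ d = 0)
    (hcomm₂ : d ∘ₗ δc + δc ∘ₗ d = 0)
    (hlap : d ∘ₗ δ + δ ∘ₗ d = dc ∘ₗ δc + δc ∘ₗ dc)
    (hHodge : HodgeDecomposition d δ) (hHodgec : HodgeDecomposition dc δc) :
    ∀ x : E, dc x = 0 → (∃ u : E, x = d u) → ∃ z : E, dc z = 0 ∧ x = d z := by
  rintro x hx ⟨u, rfl⟩
  have hu : u ∈ (LinearMap.ker dc ⊓ LinearMap.ker δc) ⊔ LinearMap.range dc ⊔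
      LinearMap.range δc := hHodgec.2 ▸ Submodule.mem_top
  obtain ⟨z, hz, _, ⟨b, rfl⟩, rfl⟩ := Submodule.mem_sup.1 hu
  have hz_ker : dc z = 0 :=
    (sup_le inf_le_left (LinearMap.range_le_ker_iff.2 hdc) :
      (LinearMap.ker dc ⊓ LinearMap.ker δc) ⊔ LinearMap.range dc ≤ LinearMap.ker dc) hz
  have hdz : dc (d z) = 0 := by
    simpa [hz_ker] using LinearMap.congr_fun hcomm₁ z
  have hw_ker : dc (d (δc b)) = 0 := by
    simpa [hdz] using hx
  have hw_eq : d (δc b) = -δc (d b) :=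
    eq_neg_of_add_eq_zero_left (LinearMap.congr_fun hcomm₂ b)
  have hw : d (δc b) = 0 := by
    rw [← inner_self_eq_zero (𝕜 := ℂ)]
    calc ⟪d (δc b), d (δc b)⟫ = -⟪d (δc b), δc (d b)⟫ := by
          nth_rw 2 [hw_eq]
          exact inner_neg_right _ _
      _ = 0 := by rw [← hadjc, hw_ker, inner_zero_left, neg_zero]
  exact ⟨z, hz_ker, by rw [map_add, hw, add_zero]⟩
end
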